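/- arXiv:2301.08396 — 8 statements merged into one kernel-verified Lean document; each statement's English description precedes it below -/
import Mathlib

section
/- (Lemma 1, characterization of generalized Lie symmetries of the action.) Let L : ℝ^D × ℝ^D → ℝ be twice continuously differentiable and ρ : ℝ^D × ℝ^D → ℝ^D continuous. Then the following are equivalent: (i) for every t₁ < t₂ and every twice continuously differentiable path q : [t₁, t₂] → ℝ^D, the integral ∫_{t₁}^{t₂} ρ(q(t), q̇(t)) · ( ∂E/∂q(q(t), q̇(t)) + F(q(t), q̇(t)) q̇(t) + M(q(t), q̇(t)) q̈(t) ) dt vanishes; (ii) for all (q, v) ∈ ℝ^D × ℝ^D one has M(q,v) ρ(q,v) = 0 and ρ(q,v) · ( ∂E/∂q(q,v) + F(q,v) v ) = 0. -/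
open Matrix

/-- The partial derivative `∂L/∂v^a` of a Lagrangian `L(q, v)`. -/
noncomputable def pLv {D : ℕ} (L : (Fin D → ℝ) → (Fin D → ℝ) → ℝ)
    (q v : Fin D → ℝ) (a : Fin D) : ℝ :=
  fderiv ℝ (fun w => L q w) v (Pi.single a 1)

/-- The Hessian matrix `M_ab = ∂²L/∂v^a∂v^b`. -/
noncomputable def Mmat {D : ℕ} (L : (Fin D → ℝ) → (Fin D → ℝ) → ℝ)
    (q v : Fin D → ℝ) : Matrix (Fin D) (Fin D) ℝ :=
  Matrix.of fun a b => fderiv ℝ (fun w => pLv L q w a) v (Pi.single b 1)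

/-- The antisymmetric matrix `F_ab = ∂²L/∂v^a∂q^b − ∂²L/∂v^b∂q^a`. -/
noncomputable def Fmat {D : ℕ} (L : (Fin D → ℝ) → (Fin D → ℝ) → ℝ)
    (q v : Fin D → ℝ) : Matrix (Fin D) (Fin D) ℝ :=
  Matrix.of fun a b =>
    fderiv ℝ (fun x => pLv L x v a) q (Pi.single b 1) -
      fderiv ℝ (fun x => pLv L x v b) q (Pi.single a 1)

/-- The energy `E(q,v) = v·∂L/∂v − L`. -/
noncomputable def En {D : ℕ} (L : (Fin D → ℝ) → (Fin D → ℝ) → ℝ)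
    (q v : Fin D → ℝ) : ℝ :=
  (∑ a, v a * pLv L q v a) - L q v

section Regularity

variable {D : ℕ} {L : (Fin D → ℝ) → (Fin D → ℝ) → ℝ}

theorem contDiff_pLv (hL : ContDiff ℝ 2 (Function.uncurry L)) (a : Fin D) :
    ContDiff ℝ 1 (fun p : (Fin D → ℝ) × (Fin D → ℝ) => pLv L p.1 p.2 a) := by
  have h : ContDiff ℝ 2
      (Function.uncurry fun (p : (Fin D → ℝ) × (Fin D → ℝ)) (w : Fin D → ℝ) => L p.1 w) :=
    hL.comp (f := fun z : ((Fin D → ℝ) × (Fin D → ℝ)) × (Fin D → ℝ) => (z.1.1, z.2))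
      (by fun_prop)
  exact (h.fderiv (g := fun p => p.2) (n := 1) contDiff_snd (by norm_num)).clm_apply
    contDiff_const

theorem continuous_fderiv_fst_apply {G : (Fin D → ℝ) → (Fin D → ℝ) → ℝ}
    (hG : ContDiff ℝ 1 (Function.uncurry G)) (u : Fin D → ℝ) :
    Continuous (fun p : (Fin D → ℝ) × (Fin D → ℝ) => fderiv ℝ (fun x => G x p.2) p.1 u) := by
  have h : ContDiff ℝ 1
      (Function.uncurry fun (p : (Fin D → ℝ) × (Fin D → ℝ)) (x : Fin D → ℝ) => G x p.2) :=
    hG.comp (f := fun z : ((Fin D → ℝ) × (Fin D → ℝ)) × (Fin D → ℝ) => (z.2, z.1.2))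
      (by fun_prop)
  exact ((h.fderiv (g := fun p => p.1) (n := 0) contDiff_fst (by norm_num)).continuous).clm_apply
    continuous_const

theorem continuous_fderiv_snd_apply {G : (Fin D → ℝ) → (Fin D → ℝ) → ℝ}
    (hG : ContDiff ℝ 1 (Function.uncurry G)) (u : Fin D → ℝ) :
    Continuous (fun p : (Fin D → ℝ) × (Fin D → ℝ) => fderiv ℝ (fun w => G p.1 w) p.2 u) := by
  have h : ContDiff ℝ 1
      (Function.uncurry fun (p : (Fin D → ℝ) × (Fin D → ℝ)) (w : Fin D → ℝ) => G p.1 w) :=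
    hG.comp (f := fun z : ((Fin D → ℝ) × (Fin D → ℝ)) × (Fin D → ℝ) => (z.1.1, z.2))
      (by fun_prop)
  exact ((h.fderiv (g := fun p => p.2) (n := 0) contDiff_snd (by norm_num)).continuous).clm_apply
    continuous_const

theorem contDiff_En (hL : ContDiff ℝ 2 (Function.uncurry L)) :
    ContDiff ℝ 1 (Function.uncurry (En L)) := by
  have h1 : ContDiff ℝ 1 (fun p : (Fin D → ℝ) × (Fin D → ℝ) => L p.1 p.2) :=
    hL.of_le (by norm_num)
  have h2 := contDiff_pLv hL
  change ContDiff ℝ 1 (fun p : (Fin D → ℝ) × (Fin D → ℝ) =>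
    (∑ a, p.2 a * pLv L p.1 p.2 a) - L p.1 p.2)
  fun_prop

theorem continuous_Mmat (hL : ContDiff ℝ 2 (Function.uncurry L)) :
    Continuous (fun p : (Fin D → ℝ) × (Fin D → ℝ) => Mmat L p.1 p.2) :=
  continuous_matrix fun a b =>
    continuous_fderiv_snd_apply (G := fun q v => pLv L q v a) (contDiff_pLv hL a) (Pi.single b 1)

theorem continuous_Fmat (hL : ContDiff ℝ 2 (Function.uncurry L)) :
    Continuous (fun p : (Fin D → ℝ) × (Fin D → ℝ) => Fmat L p.1 p.2) :=
  continuous_matrix fun a b =>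
    (continuous_fderiv_fst_apply (G := fun q v => pLv L q v a) (contDiff_pLv hL a)
      (Pi.single b 1)).sub
    (continuous_fderiv_fst_apply (G := fun q v => pLv L q v b) (contDiff_pLv hL b)
      (Pi.single a 1))

theorem isSymm_Mmat (hL : ContDiff ℝ 2 (Function.uncurry L)) (q v : Fin D → ℝ) :
    (Mmat L q v).IsSymm := by
  have h : ContDiff ℝ 2 (fun w => L q w) :=
    hL.comp (f := fun w : Fin D → ℝ => (q, w)) (by fun_prop)
  have hd : DifferentiableAt ℝ (fderiv ℝ fun w => L q w) v :=
    (h.fderiv_right (m := 1) (by norm_num)).differentiable (by norm_num) v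
  have key (a b : Fin D) : Mmat L q v a b =
      fderiv ℝ (fderiv ℝ fun w => L q w) v (Pi.single b 1) (Pi.single a 1) := by
    change fderiv ℝ (fun w => fderiv ℝ (fun w => L q w) w (Pi.single a 1)) v (Pi.single b 1) = _
    rw [fderiv_clm_apply hd (differentiableAt_const _)]
    simp
  ext a b
  rw [Matrix.transpose_apply, key, key]
  exact (h.contDiffAt.isSymmSndFDerivAt (by simp)) _ _

end Regularity

theorem eq_zero_of_forall_intervalIntegral_eq_zero {f : ℝ → ℝ} (hf : Continuous f)
    (h : ∀ t₁ t₂ : ℝ, t₁ < t₂ → ∫ t in t₁..t₂, f t = 0) (t : ℝ) : f t = 0 := by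
  have hint (u : ℝ) : ∫ x in t..u, f x = 0 := by
    rcases lt_trichotomy t u with hu | rfl | hu
    · exact h _ _ hu
    · exact intervalIntegral.integral_same
    · rw [intervalIntegral.integral_symm, h _ _ hu, neg_zero]
  rw [← hf.deriv_integral f t t]
  simp [hint]

theorem deriv_quadratic_path {E : Type*} [NormedAddCommGroup E] [NormedSpace ℝ E] (q v w : E) :
    deriv (fun t : ℝ => q + t • v + (t ^ 2 / 2) • w) = fun t => v + t • w := by
  ext t
  have h1 : HasDerivAt (fun t : ℝ => t • v) ((1 : ℝ) • v) t := (hasDerivAt_id t).smul_const v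
  have h2 : HasDerivAt (fun t : ℝ => t ^ 2 / 2) t t := by
    simpa using ((hasDerivAt_id t).pow 2).div_const 2
  have h3 : HasDerivAt (fun t : ℝ => q + t • v + (t ^ 2 / 2) • w) ((1 : ℝ) • v + t • w) t :=
    (h1.const_add q).add (h2.smul_const w)
  simpa using h3.deriv

theorem deriv_affine_path {E : Type*} [NormedAddCommGroup E] [NormedSpace ℝ E] (v w : E) :
    deriv (fun t : ℝ => v + t • w) = fun _ => w := by
  ext t
  simpa using (((hasDerivAt_id t).smul_const w).const_add v).deriv

/-- Lemma 1: `ρ · ∂/∂q` generates a generalized Lie symmetry of the action,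
i.e. the variation `δS = ∫ ρ·(∂E/∂q + F q̇ + M q̈) dt` vanishes along every twice
continuously differentiable path, if and only if `M ρ = 0` and `ρ·(∂E/∂q + F v) = 0`
identically on the whole velocity phase space. -/
theorem statement1 (D : ℕ) (hD : 1 ≤ D)
    (L : (Fin D → ℝ) → (Fin D → ℝ) → ℝ)
    (hL : ContDiff ℝ 2 (Function.uncurry L))
    (ρ : (Fin D → ℝ) → (Fin D → ℝ) → (Fin D → ℝ))
    (hρ : Continuous (Function.uncurry ρ)) :
    (∀ t₁ t₂ : ℝ, t₁ < t₂ → ∀ q : ℝ → Fin D → ℝ, ContDiff ℝ 2 q →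
      (∫ t in t₁..t₂, ∑ a, ρ (q t) (deriv q t) a *
        (fderiv ℝ (fun x => En L x (deriv q t)) (q t) (Pi.single a 1)
          + (Fmat L (q t) (deriv q t)).mulVec (deriv q t) a
          + (Mmat L (q t) (deriv q t)).mulVec (deriv (deriv q) t) a)) = 0)
    ↔
    (∀ q v : Fin D → ℝ,
      (Mmat L q v).mulVec (ρ q v) = 0 ∧
      (∑ a, ρ q v a *
        (fderiv ℝ (fun x => En L x v) q (Pi.single a 1)
          + (Fmat L q v).mulVec v a)) = 0) := by
  have hsplit (q v w : Fin D → ℝ) :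
      (∑ a, ρ q v a * (fderiv ℝ (fun x => En L x v) q (Pi.single a 1)
          + (Fmat L q v).mulVec v a + (Mmat L q v).mulVec w a)) =
      (∑ a, ρ q v a * (fderiv ℝ (fun x => En L x v) q (Pi.single a 1)
          + (Fmat L q v).mulVec v a)) + (Mmat L q v).mulVec (ρ q v) ⬝ᵥ w := by
    have hM : (Mmat L q v).mulVec (ρ q v) ⬝ᵥ w = ρ q v ⬝ᵥ (Mmat L q v).mulVec w := by
      rw [Matrix.dotProduct_mulVec, ← Matrix.mulVec_transpose, (isSymm_Mmat hL q v).eq]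
    rw [hM, dotProduct, ← Finset.sum_add_distrib]
    simp only [mul_add]
  simp only [hsplit]
  constructor
  · intro h q v
    have key (w : Fin D → ℝ) :
        (∑ a, ρ q v a * (fderiv ℝ (fun x => En L x v) q (Pi.single a 1)
          + (Fmat L q v).mulVec v a)) + (Mmat L q v).mulVec (ρ q v) ⬝ᵥ w = 0 := by
      have hpath : ContDiff ℝ 2 (fun t : ℝ => q + t • v + (t ^ 2 / 2) • w) := by fun_prop
      have hx : Continuous (fun t : ℝ => (q + t • v + (t ^ 2 / 2) • w, v + t • w)) := by
        fun_prop
      have hE (a : Fin D) := (continuous_fderiv_fst_apply (contDiff_En hL) (Pi.single a 1)).comp hx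
      have hF := (continuous_Fmat hL).comp hx
      have hM := (continuous_Mmat hL).comp hx
      have hr := hρ.comp hx
      simp only [Function.comp_def, Function.uncurry_apply_pair] at hE hF hM hr
      have h0 := eq_zero_of_forall_intervalIntegral_eq_zero (f := fun t : ℝ => _)
        ?_ (fun t₁ t₂ ht => h t₁ t₂ ht _ hpath) 0
      · simp only [deriv_quadratic_path, deriv_affine_path] at h0
        simpa using h0
      · simp only [deriv_quadratic_path, deriv_affine_path]
        have hra (a : Fin D) := (continuous_apply a).comp hr
        have hFv (a : Fin D) := (continuous_apply a).comp
          (hF.matrix_mulVec (by fun_prop : Continuous fun t : ℝ => v + t • w))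
        refine .add (continuous_finsetSum _ fun a _ => (hra a).mul ((hE a).add (hFv a)))
          ((hM.matrix_mulVec hr).dotProduct continuous_const)
    have h0 := key 0
    rw [dotProduct_zero, add_zero] at h0
    refine ⟨dotProduct_eq_zero_iff.mp fun w => ?_, h0⟩
    simpa [h0] using key w
  · intro h t₁ t₂ _ q _
    simp [h]
end

section
/- (Theorem 1, structure of the kernel of the Lagrangian two-form.) Let M be a symmetric real D×D matrix and F an antisymmetric real D×D matrix, and let Ω be the associated bilinear form on ℝ^D × ℝ^D. Then K = (k, u) lies in ker Ω if and only if M k = 0 and M u = −F k. Moreover, if (k, u) ∈ ker Ω then z · (F k) = 0 for every z ∈ ker M, and if (k, u) and (k, u′) both lie in ker Ω then u − u′ ∈ ker M (the vertical part is unique up to an element of ker M). -/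
open Matrix

/-- The Lagrangian two-form at a point, as a bilinear form on `ℝ^D × ℝ^D`:
`Ω((x,u),(y,w)) = x·(F y) + x·(M w) − y·(M u)`. -/
def Omega {D : ℕ} (M F : Matrix (Fin D) (Fin D) ℝ)
    (K Y : (Fin D → ℝ) × (Fin D → ℝ)) : ℝ :=
  K.1 ⬝ᵥ (F *ᵥ Y.1) + K.1 ⬝ᵥ (M *ᵥ Y.2) - Y.1 ⬝ᵥ (M *ᵥ K.2)

/-- The kernel of the Lagrangian two-form. -/
def kerOmega {D : ℕ} (M F : Matrix (Fin D) (Fin D) ℝ) :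
    Set ((Fin D → ℝ) × (Fin D → ℝ)) :=
  {K | ∀ Y, Omega M F K Y = 0}

theorem Matrix.dotProduct_mulVec_eq_transpose_mulVec_dotProduct {m n R : Type*} [Fintype m]
    [Fintype n] [CommSemiring R] (A : Matrix m n R) (x : m → R) (y : n → R) :
    x ⬝ᵥ (A *ᵥ y) = (Aᵀ *ᵥ x) ⬝ᵥ y := by
  rw [Matrix.dotProduct_mulVec, Matrix.mulVec_transpose]

theorem Omega_eq_dotProduct_sub {D : ℕ} {M F : Matrix (Fin D) (Fin D) ℝ}
    (hM : M.IsSymm) (hF : Fᵀ = -F) (K Y : (Fin D → ℝ) × (Fin D → ℝ)) :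
    Omega M F K Y = (M *ᵥ K.1) ⬝ᵥ Y.2 - (M *ᵥ K.2 + F *ᵥ K.1) ⬝ᵥ Y.1 := by
  rw [Omega, Matrix.dotProduct_mulVec_eq_transpose_mulVec_dotProduct F,
    Matrix.dotProduct_mulVec_eq_transpose_mulVec_dotProduct M K.1, hM.eq, hF,
    dotProduct_comm Y.1, Matrix.neg_mulVec, neg_dotProduct, add_dotProduct]
  ring

theorem mem_kerOmega_iff {D : ℕ} {M F : Matrix (Fin D) (Fin D) ℝ}
    (hM : M.IsSymm) (hF : Fᵀ = -F) (k u : Fin D → ℝ) :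
    (k, u) ∈ kerOmega M F ↔ M *ᵥ k = 0 ∧ M *ᵥ u = -(F *ᵥ k) := by
  simp only [kerOmega, Set.mem_ofPred_eq, Omega_eq_dotProduct_sub hM hF]
  constructor
  · intro h
    refine ⟨dotProduct_eq_zero _ fun w => ?_,
      eq_neg_of_add_eq_zero_left (dotProduct_eq_zero _ fun y => ?_)⟩
    · simpa using h (0, w)
    · simpa only [dotProduct_zero, zero_sub, neg_eq_zero] using h (y, 0)
  · rintro ⟨hk, hu⟩ Y
    simp [hk, hu]

/-- Theorem 1: `(k,u) ∈ ker Ω` iff `M k = 0` and `M u = −F k`; moreover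
`z·(F k) = 0` for all `z ∈ ker M`, and the vertical part `u` is unique up to `ker M`. -/
theorem statement3 (D : ℕ) (hD : 1 ≤ D)
    (M F : Matrix (Fin D) (Fin D) ℝ)
    (hM : M.IsSymm) (hF : Fᵀ = -F) :
    (∀ k u : Fin D → ℝ,
      (k, u) ∈ kerOmega M F ↔ M *ᵥ k = 0 ∧ M *ᵥ u = -(F *ᵥ k)) ∧
    (∀ k u : Fin D → ℝ, (k, u) ∈ kerOmega M F →
      ∀ z : Fin D → ℝ, M *ᵥ z = 0 → z ⬝ᵥ (F *ᵥ k) = 0) ∧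
    (∀ k u u' : Fin D → ℝ, (k, u) ∈ kerOmega M F → (k, u') ∈ kerOmega M F →
      M *ᵥ (u - u') = 0) := by
  refine ⟨mem_kerOmega_iff hM hF, fun k u h z hz => ?_, fun k u u' h h' => ?_⟩
  · have hu := ((mem_kerOmega_iff hM hF k u).1 h).2
    rw [← neg_eq_iff_eq_neg.2 hu, dotProduct_neg,
      Matrix.dotProduct_mulVec_eq_transpose_mulVec_dotProduct, hM.eq, hz, zero_dotProduct, neg_zero]
  · rw [Matrix.mulVec_sub, ((mem_kerOmega_iff hM hF k u).1 h).2,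
      ((mem_kerOmega_iff hM hF k u').1 h').2, sub_self]
end

section
/- (Dimension of the kernel of the Lagrangian two-form.) Let M be a symmetric real D×D matrix and F an antisymmetric real D×D matrix, and let Ω be the associated bilinear form on ℝ^D × ℝ^D. Define the subspace C̄ := { k ∈ ker M : z · (F k) = 0 for all z ∈ ker M } of ℝ^D. Then dim (ker Ω) = dim (ker M) + dim C̄; in particular, writing N₀ := dim (ker M) and D̄ := dim C̄, one has D̄ ≤ N₀ and dim (ker Ω) = N₀ + D̄ ≤ 2N₀. -/
open Matrix

/-- The kernel of the Lagrangian two-form, as a subspace of `ℝ^D × ℝ^D`. -/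
def kerOmegaSub {D : ℕ} (M F : Matrix (Fin D) (Fin D) ℝ) :
    Submodule ℝ ((Fin D → ℝ) × (Fin D → ℝ)) where
  carrier := {K | ∀ Y, Omega M F K Y = 0}
  add_mem' := by
    intro a b ha hb Y
    have h : Omega M F (a + b) Y = Omega M F a Y + Omega M F b Y := by
      simp only [Omega, Prod.fst_add, Prod.snd_add, add_dotProduct, Matrix.mulVec_add,
        dotProduct_add]
      ring
    rw [h, ha Y, hb Y, add_zero]
  zero_mem' := by
    intro Y
    simp [Omega]
  smul_mem' := by
    intro c a ha Y
    have h : Omega M F (c • a) Y = c * Omega M F a Y := by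
      simp only [Omega, Prod.smul_fst, Prod.smul_snd, smul_dotProduct, Matrix.mulVec_smul,
        dotProduct_smul, smul_eq_mul]
      ring
    rw [h, ha Y, mul_zero]

/-- The subspace `C̄ = { k ∈ ker M : z·(F k) = 0 for all z ∈ ker M }` of `ℝ^D`. -/
def CbarSub {D : ℕ} (M F : Matrix (Fin D) (Fin D) ℝ) :
    Submodule ℝ (Fin D → ℝ) where
  carrier := {k | M *ᵥ k = 0 ∧ ∀ z, M *ᵥ z = 0 → z ⬝ᵥ (F *ᵥ k) = 0}
  add_mem' := by
    intro a b ha hb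
    refine ⟨?_, ?_⟩
    · rw [Matrix.mulVec_add, ha.1, hb.1, add_zero]
    · intro z hz
      rw [Matrix.mulVec_add, dotProduct_add, ha.2 z hz, hb.2 z hz, add_zero]
  zero_mem' := by
    refine ⟨by simp, ?_⟩
    intro z hz
    simp
  smul_mem' := by
    intro c a ha
    refine ⟨?_, ?_⟩
    · rw [Matrix.mulVec_smul, ha.1, smul_zero]
    · intro z hz
      rw [Matrix.mulVec_smul, dotProduct_smul, ha.2 z hz, smul_zero]

/-- Fredholm alternative over a field: a vector orthogonal to `ker A` lies in the range of `Aᵀ`. -/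
theorem exists_transpose_mulVec_eq_of_orthogonal_ker {K m n : Type*} [Field K] [Fintype m]
    [DecidableEq m] [Fintype n] [DecidableEq n] (A : Matrix m n K) (v : n → K)
    (hv : ∀ z, A *ᵥ z = 0 → z ⬝ᵥ v = 0) : ∃ u, Aᵀ *ᵥ u = v := by
  have hmem : dotProductEquiv K n v ∈ LinearMap.range A.mulVecLin.dualMap := by
    rw [LinearMap.range_dualMap_eq_dualAnnihilator_ker, Submodule.mem_dualAnnihilator]
    intro z hz
    rw [dotProductEquiv_apply_apply, dotProduct_comm]
    exact hv z (by simpa using hz)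
  obtain ⟨ψ, hψ⟩ := hmem
  refine ⟨(dotProductEquiv K m).symm ψ, dotProduct_eq _ _ fun z ↦ ?_⟩
  have hz := LinearMap.congr_fun hψ z
  rw [LinearMap.dualMap_apply, dotProductEquiv_apply_apply, mulVecLin_apply] at hz
  rw [← hz, mulVec_transpose, ← dotProduct_mulVec, ← dotProductEquiv_apply_apply,
    LinearEquiv.apply_symm_apply]

/-- The equations `M x = 0`, `F x + M u = 0` cutting out the kernel of the Lagrangian two-form. -/
theorem mem_kerOmegaSub_iff {D : ℕ} {M F : Matrix (Fin D) (Fin D) ℝ} (hM : M.IsSymm)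
    (hF : Fᵀ = -F) (K : (Fin D → ℝ) × (Fin D → ℝ)) :
    K ∈ kerOmegaSub M F ↔ M *ᵥ K.1 = 0 ∧ F *ᵥ K.1 + M *ᵥ K.2 = 0 := by
  have hΩ : ∀ Y, Omega M F K Y = (M *ᵥ K.1) ⬝ᵥ Y.2 - (F *ᵥ K.1 + M *ᵥ K.2) ⬝ᵥ Y.1 := by
    intro Y
    have h₁ : K.1 ⬝ᵥ (F *ᵥ Y.1) = -((F *ᵥ K.1) ⬝ᵥ Y.1) := by
      rw [dotProduct_mulVec, ← mulVec_transpose, hF, neg_mulVec, neg_dotProduct]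
    have h₂ : K.1 ⬝ᵥ (M *ᵥ Y.2) = (M *ᵥ K.1) ⬝ᵥ Y.2 := by
      rw [dotProduct_mulVec, ← mulVec_transpose, hM.eq]
    rw [Omega, h₁, h₂, add_dotProduct, dotProduct_comm Y.1]
    ring
  constructor
  · intro hK
    constructor
    · refine dotProduct_eq_zero _ fun w ↦ ?_
      simpa [hΩ] using hK (0, w)
    · refine dotProduct_eq_zero _ fun y ↦ ?_
      have h := hK (y, 0)
      rw [hΩ, dotProduct_zero, zero_sub, neg_eq_zero] at h
      exact h
  · rintro ⟨h₁, h₂⟩ Y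
    rw [hΩ, h₁, h₂, zero_dotProduct, zero_dotProduct, sub_zero]

theorem CbarSub_le_ker {D : ℕ} (M F : Matrix (Fin D) (Fin D) ℝ) :
    CbarSub M F ≤ LinearMap.ker M.mulVecLin :=
  fun _ hk ↦ hk.1

theorem map_fst_kerOmegaSub {D : ℕ} {M F : Matrix (Fin D) (Fin D) ℝ} (hM : M.IsSymm)
    (hF : Fᵀ = -F) :
    (kerOmegaSub M F).map (LinearMap.fst ℝ (Fin D → ℝ) (Fin D → ℝ)) = CbarSub M F := by
  ext x
  constructor
  · rintro ⟨K, hK, rfl⟩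
    obtain ⟨h₁, h₂⟩ := (mem_kerOmegaSub_iff hM hF K).1 hK
    refine ⟨h₁, fun z hz ↦ ?_⟩
    rw [LinearMap.fst_apply, eq_neg_of_add_eq_zero_left h₂, dotProduct_neg, dotProduct_mulVec,
      ← mulVec_transpose, hM.eq, hz, zero_dotProduct, neg_zero]
  · rintro ⟨h₁, h₂⟩
    obtain ⟨u, hu⟩ := exists_transpose_mulVec_eq_of_orthogonal_ker M (F *ᵥ x) h₂
    rw [hM.eq] at hu
    refine ⟨(x, -u), (mem_kerOmegaSub_iff hM hF _).2 ⟨h₁, ?_⟩, rfl⟩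
    rw [mulVec_neg, hu, add_neg_cancel]

theorem comap_inr_kerOmegaSub {D : ℕ} {M F : Matrix (Fin D) (Fin D) ℝ} (hM : M.IsSymm)
    (hF : Fᵀ = -F) :
    (kerOmegaSub M F).comap (LinearMap.inr ℝ (Fin D → ℝ) (Fin D → ℝ)) =
      LinearMap.ker M.mulVecLin := by
  ext u
  simp [mem_kerOmegaSub_iff hM hF]

/-- Rank-nullity for the first projection restricted to a subspace of a product. -/
theorem finrank_eq_finrank_comap_inr_add_finrank_map_fst {K V W : Type*} [DivisionRing K]
    [AddCommGroup V] [Module K V] [AddCommGroup W] [Module K W] [FiniteDimensional K V]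
    [FiniteDimensional K W] (S : Submodule K (V × W)) :
    Module.finrank K S = Module.finrank K (S.comap (LinearMap.inr K V W)) +
      Module.finrank K (S.map (LinearMap.fst K V W)) := by
  have hker : (LinearMap.ker ((LinearMap.fst K V W).domRestrict S)).map S.subtype =
      (S.comap (LinearMap.inr K V W)).map (LinearMap.inr K V W) := by
    rw [LinearMap.ker_domRestrict, Submodule.map_comap_subtype,
      Submodule.map_comap_eq, LinearMap.ker_fst, inf_comm]
  rw [← LinearMap.finrank_range_add_finrank_ker ((LinearMap.fst K V W).domRestrict S),
    LinearMap.range_domRestrict, add_comm,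
    (Submodule.equivMapOfInjective S.subtype S.injective_subtype _).finrank_eq, hker,
    ← (Submodule.equivMapOfInjective _ LinearMap.inr_injective _).finrank_eq]

/-- `dim (ker Ω) = dim (ker M) + dim C̄`; in particular, with
`N₀ = dim (ker M)` and `D̄ = dim C̄`, one has `D̄ ≤ N₀` and `dim (ker Ω) ≤ 2 N₀`. -/
theorem statement4 (D : ℕ) (hD : 1 ≤ D)
    (M F : Matrix (Fin D) (Fin D) ℝ)
    (hM : M.IsSymm) (hF : Fᵀ = -F) :
    Module.finrank ℝ (kerOmegaSub M F)
        = Module.finrank ℝ (LinearMap.ker M.mulVecLin)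
          + Module.finrank ℝ (CbarSub M F) ∧
    Module.finrank ℝ (CbarSub M F) ≤ Module.finrank ℝ (LinearMap.ker M.mulVecLin) ∧
    Module.finrank ℝ (kerOmegaSub M F)
        ≤ 2 * Module.finrank ℝ (LinearMap.ker M.mulVecLin) := by
  have hdim := finrank_eq_finrank_comap_inr_add_finrank_map_fst (kerOmegaSub M F)
  rw [comap_inr_kerOmegaSub hM hF, map_fst_kerOmegaSub hM hF] at hdim
  have hle := Submodule.finrank_mono (CbarSub_le_ker M F)
  exact ⟨hdim, hle, by omega⟩
end

section
/- (The antisymmetric matrix F for the conformal Lagrangian L₁.) Let m > 0, let V : ℝ^D \ {0} → ℝ be differentiable, and define L₁(q,v) := (m/2) (v · Π(q) v)/‖q‖² − V(q) for q ≠ 0. Then the matrix F₁(q,v) with entries F_ab := ∂²L₁/∂v^a∂q^b − ∂²L₁/∂v^b∂q^a is given by F_ab = (m/‖q‖³) ( q̂_a (Π(q)v)_b − q̂_b (Π(q)v)_a ); equivalently, F₁(q,v) w = (m/‖q‖³) ( ((Π(q)v)·w) q̂ − (q̂·w) Π(q)v ) for all w ∈ ℝ^D. -/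
open scoped RealInnerProductSpace

/-- The unit vector `q̂ = q/‖q‖`. -/
noncomputable def nhat {D : ℕ} (q : EuclideanSpace ℝ (Fin D)) : EuclideanSpace ℝ (Fin D) :=
  ‖q‖⁻¹ • q

/-- The orthogonal projection `Π(q)w = w − (q̂·w) q̂` onto the hyperplane orthogonal to `q`. -/
noncomputable def proj {D : ℕ} (q w : EuclideanSpace ℝ (Fin D)) : EuclideanSpace ℝ (Fin D) :=
  w - ⟪nhat q, w⟫ • nhat q

/-- The conformal Lagrangian `L₁(q,v) = (m/2)(v·Π(q)v)/‖q‖² − V(q)`. -/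
noncomputable def L1 {D : ℕ} (m : ℝ) (V : EuclideanSpace ℝ (Fin D) → ℝ)
    (q v : EuclideanSpace ℝ (Fin D)) : ℝ :=
  m / 2 * ⟪v, proj q v⟫ / ‖q‖ ^ 2 - V q

/-- The mixed second-derivative operator `A(q,v) : w ↦ D_q( ∇_v L₁ )(q)(w)`, whose matrix
entries are `A_ab = ∂²L₁/∂q^b ∂v^a`. -/
noncomputable def Aop {D : ℕ} (m : ℝ) (V : EuclideanSpace ℝ (Fin D) → ℝ)
    (q v w : EuclideanSpace ℝ (Fin D)) : EuclideanSpace ℝ (Fin D) :=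
  fderiv ℝ (fun x => gradient (fun v' => L1 m V x v') v) q w

theorem gradient_L1 {D : ℕ} (m : ℝ) (V : EuclideanSpace ℝ (Fin D) → ℝ)
    (x v : EuclideanSpace ℝ (Fin D)) :
    gradient (fun v' => L1 m V x v') v
      = m • ((‖x‖ ^ 2)⁻¹ • v - (((‖x‖ ^ 2)⁻¹) ^ 2 * ⟪x, v⟫) • x) := by
  apply HasGradientAt.gradient
  rw [hasGradientAt_iff_hasFDerivAt]
  have hL : (fun v' => L1 m V x v') = fun v' =>
      m / 2 * ((‖x‖ ^ 2)⁻¹ * ⟪v', v'⟫ - ((‖x‖ ^ 2)⁻¹) ^ 2 * (⟪x, v'⟫ * ⟪x, v'⟫)) - V x := by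
    funext v'
    simp only [L1, proj, nhat, inner_sub_right, inner_smul_left, inner_smul_right,
      real_inner_comm x v', RCLike.conj_to_real]
    ring
  rw [hL]
  have hx : HasFDerivAt (fun v' : EuclideanSpace ℝ (Fin D) => ⟪x, v'⟫) (innerSL ℝ x) v :=
    (innerSL ℝ x).hasFDerivAt
  have hv := (hasFDerivAt_id (𝕜 := ℝ) v).inner ℝ (hasFDerivAt_id v)
  refine ((((hv.const_mul _).sub ((hx.mul hx).const_mul _)).const_mul _).sub_const _).congr_fderiv
    ?_
  ext w
  simp [real_inner_comm w v]
  ring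

theorem inner_Aop {D : ℕ} (m : ℝ) (V : EuclideanSpace ℝ (Fin D) → ℝ)
    {q : EuclideanSpace ℝ (Fin D)} (hq : q ≠ 0) (v w z : EuclideanSpace ℝ (Fin D)) :
    ⟪z, Aop m V q v w⟫
      = m * (-2 * ⟪q, w⟫ * ⟪z, v⟫ / ‖q‖ ^ 4 + 4 * ⟪q, w⟫ * ⟪q, v⟫ * ⟪z, q⟫ / ‖q‖ ^ 6
          - ⟪w, v⟫ * ⟪z, q⟫ / ‖q‖ ^ 4 - ⟪q, v⟫ * ⟪z, w⟫ / ‖q‖ ^ 4) := by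
  have hn : ‖q‖ ≠ 0 := norm_ne_zero_iff.mpr hq
  have hid := hasFDerivAt_id (𝕜 := ℝ) q
  have hs : HasFDerivAt (fun x : EuclideanSpace ℝ (Fin D) => (‖x‖ ^ 2)⁻¹) _ q :=
    (hasDerivAt_inv (pow_ne_zero 2 hn)).comp_hasFDerivAt q hid.norm_sq
  have hi := hid.inner ℝ (hasFDerivAt_const v q)
  have h := ((hs.smul_const v).sub (((hs.pow 2).mul hi).smul hid)).const_smul m
  simp only [Aop, gradient_L1]
  erw [h.fderiv]
  simp [inner_sub_right, inner_add_right, inner_smul_right]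
  field_simp
  left
  ring

/-- the antisymmetric matrix `F₁` of `L₁`, with entries
`F_ab = ∂²L₁/∂v^a∂q^b − ∂²L₁/∂v^b∂q^a`, is given as an operator by
`F₁(q,v) w = (m/‖q‖³)( ((Π(q)v)·w) q̂ − (q̂·w) Π(q)v )`; equivalently, for all `w, z`:
`z·(F₁ w) = z·(A w) − w·(A z)` equals `z` paired with the displayed formula. -/
theorem statement9 (D : ℕ) (hD : 1 ≤ D) (m : ℝ) (hm : 0 < m)
    (V : EuclideanSpace ℝ (Fin D) → ℝ)
    (hV : ∀ x : EuclideanSpace ℝ (Fin D), x ≠ 0 → DifferentiableAt ℝ V x)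
    (q v : EuclideanSpace ℝ (Fin D)) (hq : q ≠ 0) :
    ∀ w z : EuclideanSpace ℝ (Fin D),
      ⟪z, Aop m V q v w⟫ - ⟪w, Aop m V q v z⟫
        = ⟪z, (m / ‖q‖ ^ 3) • (⟪proj q v, w⟫ • nhat q - ⟪nhat q, w⟫ • proj q v)⟫ := by
  intro w z
  have hn : ‖q‖ ≠ 0 := norm_ne_zero_iff.mpr hq
  rw [inner_Aop m V hq, inner_Aop m V hq]
  simp only [proj, nhat, inner_sub_left, inner_sub_right, inner_smul_left, inner_smul_right,
    RCLike.conj_to_real, real_inner_comm q z, real_inner_comm q w, real_inner_comm z w,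
    real_inner_comm v w, real_inner_comm v z]
  field_simp
  ring
end

section
/- (The first-order Lagrangian constraint of the system S₁.) Let m > 0, let V : ℝ^D \ {0} → ℝ be continuously differentiable, let E₁(q,v) := (m/2) (v · Π(q) v)/‖q‖² + V(q) be the energy, and let F₁(q,v) be the antisymmetric matrix with F₁(q,v) w = (m/‖q‖³) ( ((Π(q)v)·w) q̂ − (q̂·w) Π(q)v ). Then for all q ≠ 0 and all v, the kinetic contributions cancel in the contraction with q̂: q̂ · ( ∇_q E₁(q,v) + F₁(q,v) v ) = q̂ · ∇V(q). Hence the unique first-order Lagrangian constraint function of S₁ is γ^[1] = q̂ · ∇V. -/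
open scoped RealInnerProductSpace

/-- The energy `E₁(q,v) = (m/2)(v·Π(q)v)/‖q‖² + V(q)` of the system `S₁`. -/
noncomputable def E1 {D : ℕ} (m : ℝ) (V : EuclideanSpace ℝ (Fin D) → ℝ)
    (q v : EuclideanSpace ℝ (Fin D)) : ℝ :=
  m / 2 * ⟪v, proj q v⟫ / ‖q‖ ^ 2 + V q

/-- The antisymmetric operator `F₁(q,v) w = (m/‖q‖³)( ((Π(q)v)·w) q̂ − (q̂·w) Π(q)v )`. -/
noncomputable def F1op {D : ℕ} (m : ℝ)
    (q v w : EuclideanSpace ℝ (Fin D)) : EuclideanSpace ℝ (Fin D) :=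
  (m / ‖q‖ ^ 3) • (⟪proj q v, w⟫ • nhat q - ⟪nhat q, w⟫ • proj q v)

lemma norm_nhat {D : ℕ} {q : EuclideanSpace ℝ (Fin D)} (hq : q ≠ 0) : ‖nhat q‖ = 1 := by
  rw [nhat, norm_smul, norm_inv, norm_norm, inv_mul_cancel₀ (norm_ne_zero_iff.2 hq)]

lemma inner_nhat_proj {D : ℕ} {q : EuclideanSpace ℝ (Fin D)} (hq : q ≠ 0)
    (w : EuclideanSpace ℝ (Fin D)) : ⟪nhat q, proj q w⟫ = 0 := by
  rw [proj, inner_sub_right, real_inner_smul_right, real_inner_self_eq_norm_sq, norm_nhat hq]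
  ring

lemma nhat_smul_of_pos {D : ℕ} {t : ℝ} (ht : 0 < t) (q : EuclideanSpace ℝ (Fin D)) :
    nhat (t • q) = nhat q := by
  rw [nhat, nhat, norm_smul, Real.norm_of_nonneg ht.le, smul_smul]
  congr 1
  field_simp

/-- The kinetic energy `(m/2)(v·Π(q)v)/‖q‖²` of the system `S₁`. -/
noncomputable def kineticEnergy {D : ℕ} (m : ℝ) (v q : EuclideanSpace ℝ (Fin D)) : ℝ :=
  m / 2 * ⟪v, proj q v⟫ / ‖q‖ ^ 2

lemma kineticEnergy_smul_of_pos {D : ℕ} (m : ℝ) {t : ℝ} (ht : 0 < t)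
    (v q : EuclideanSpace ℝ (Fin D)) :
    kineticEnergy m v (t • q) = (t ^ 2)⁻¹ * kineticEnergy m v q := by
  rw [kineticEnergy, kineticEnergy, proj, nhat_smul_of_pos ht, ← proj, norm_smul, mul_pow,
    Real.norm_eq_abs, sq_abs, mul_comm (t ^ 2), ← div_div, div_eq_inv_mul]

lemma differentiableAt_kineticEnergy {D : ℕ} (m : ℝ) (v : EuclideanSpace ℝ (Fin D))
    {q : EuclideanSpace ℝ (Fin D)} (hq : q ≠ 0) :
    DifferentiableAt ℝ (kineticEnergy m v) q := by
  have hn : DifferentiableAt ℝ (fun x : EuclideanSpace ℝ (Fin D) => ‖x‖) q :=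
    differentiableAt_id.norm ℝ hq
  have hq' : ‖q‖ ≠ 0 := norm_ne_zero_iff.2 hq
  have hnhat : DifferentiableAt ℝ (nhat (D := D)) q := (hn.inv hq').smul differentiableAt_id
  have hinner : DifferentiableAt ℝ (fun x => ⟪nhat x, v⟫) q :=
    hnhat.inner ℝ (differentiableAt_const v)
  have hproj : DifferentiableAt ℝ (fun x => proj x v) q :=
    (differentiableAt_const v).sub (hinner.smul hnhat)
  have hnum : DifferentiableAt ℝ (fun x => m / 2 * ⟪v, proj x v⟫) q :=
    ((differentiableAt_const v).inner ℝ hproj).const_mul (m / 2)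
  have hdiv : DifferentiableAt ℝ (fun x => m / 2 * ⟪v, proj x v⟫ * (‖x‖ ^ 2)⁻¹) q :=
    hnum.fun_mul ((hn.fun_pow 2).fun_inv (pow_ne_zero 2 hq'))
  exact hdiv

/-- Euler's identity for the kinetic energy, which is homogeneous of degree `-2`. -/
lemma fderiv_kineticEnergy_self {D : ℕ} (m : ℝ) (v : EuclideanSpace ℝ (Fin D))
    {q : EuclideanSpace ℝ (Fin D)} (hq : q ≠ 0) :
    fderiv ℝ (kineticEnergy m v) q q = -2 * kineticEnergy m v q := by
  have hline : HasDerivAt (fun t : ℝ => t • q) q 1 := by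
    simpa using (hasDerivAt_id (1 : ℝ)).smul_const q
  have hK : HasFDerivAt (kineticEnergy m v) (fderiv ℝ (kineticEnergy m v) q) ((1 : ℝ) • q) := by
    rw [one_smul]
    exact (differentiableAt_kineticEnergy m v hq).hasFDerivAt
  have hpow : HasDerivAt (fun t : ℝ => (t ^ 2)⁻¹ * kineticEnergy m v q)
      (-2 * kineticEnergy m v q) 1 := by
    simpa using (((hasDerivAt_pow 2 (1 : ℝ)).fun_inv (by norm_num)).mul_const
      (kineticEnergy m v q))
  refine (hK.comp_hasDerivAt (1 : ℝ) hline).unique (hpow.congr_of_eventuallyEq ?_)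
  filter_upwards [lt_mem_nhds (zero_lt_one' ℝ)] with t ht
  exact kineticEnergy_smul_of_pos m ht v q

lemma inner_nhat_F1op_self {D : ℕ} (m : ℝ) {q : EuclideanSpace ℝ (Fin D)} (hq : q ≠ 0)
    (v : EuclideanSpace ℝ (Fin D)) :
    ⟪nhat q, F1op m q v v⟫ = m / ‖q‖ ^ 3 * ⟪v, proj q v⟫ := by
  rw [F1op, real_inner_smul_right, inner_sub_right, real_inner_smul_right, real_inner_smul_right,
    inner_nhat_proj hq, real_inner_self_eq_norm_sq, norm_nhat hq, real_inner_comm v]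
  ring

/-- the kinetic contributions cancel in the contraction with `q̂`:
`q̂ · ( ∇_q E₁(q,v) + F₁(q,v) v ) = q̂ · ∇V(q)`, so the unique first-order Lagrangian
constraint of the system `S₁` is `γ^[1] = q̂ · ∇V`. -/
theorem statement10 (D : ℕ) (hD : 1 ≤ D) (m : ℝ) (hm : 0 < m)
    (V : EuclideanSpace ℝ (Fin D) → ℝ)
    (hV : ContDiffOn ℝ 1 V {x : EuclideanSpace ℝ (Fin D) | x ≠ 0})
    (q v : EuclideanSpace ℝ (Fin D)) (hq : q ≠ 0) :
    ⟪nhat q, gradient (fun x => E1 m V x v) q + F1op m q v v⟫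
      = ⟪nhat q, gradient V q⟫ := by
  have hVd : DifferentiableAt ℝ V q :=
    (hV.differentiableOn one_ne_zero).differentiableAt (isOpen_ne.mem_nhds hq)
  have hE : fderiv ℝ (fun x => E1 m V x v) q
      = fderiv ℝ (kineticEnergy m v) q + fderiv ℝ V q :=
    fderiv_add (differentiableAt_kineticEnergy m v hq) hVd
  have hgrad (f : EuclideanSpace ℝ (Fin D) → ℝ) :
      ⟪nhat q, gradient f q⟫ = fderiv ℝ f q (nhat q) := by
    rw [real_inner_comm, gradient, InnerProductSpace.toDual_symm_apply]
  have hK : fderiv ℝ (kineticEnergy m v) q (nhat q) = -(m / ‖q‖ ^ 3 * ⟪v, proj q v⟫) := by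
    rw [nhat, map_smul, fderiv_kineticEnergy_self m v hq, kineticEnergy, smul_eq_mul]
    have hq' : ‖q‖ ≠ 0 := norm_ne_zero_iff.2 hq
    field_simp
  rw [inner_add_right, hgrad, hgrad, hE, add_apply, hK,
    inner_nhat_F1op_self m hq]
  ring
end

section
/- (Appendix result: reduction of the Euler–Lagrange equations of S₁ for a potential V = V_Sph + V_AS.) Let m > 0, let f : (0,∞) → ℝ be differentiable, let W : ℝ^D \ {0} → ℝ be differentiable with W(λq) = W(q) for all λ > 0, and set V(q) := f(‖q‖) + W(q). Suppose q : I → ℝ^D \ {0} is a twice differentiable curve on an interval I satisfying, for all t ∈ I, 0 = (m/‖q‖³) Π(q) q̈ − (2m/‖q‖³)(q̂·q̇) Π(q) q̇ + ∇V(q). Then for all t ∈ I: (a) f′(‖q(t)‖) = 0 (the first-order Lagrangian constraint), and (b) q satisfies the same equation with V replaced by W: 0 = (m/‖q‖³) Π(q) q̈ − (2m/‖q‖³)(q̂·q̇) Π(q) q̇ + ∇W(q). -/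
open scoped RealInnerProductSpace

/-- The projection onto the hyperplane orthogonal to `q` takes values orthogonal to `q`. -/
theorem inner_proj_eq_zero {D : ℕ} {q : EuclideanSpace ℝ (Fin D)} (hq : q ≠ 0)
    (w : EuclideanSpace ℝ (Fin D)) : ⟪q, proj q w⟫ = 0 := by
  have h : ‖q‖ ≠ 0 := norm_ne_zero_iff.mpr hq
  simp only [proj, nhat, inner_sub_right, real_inner_smul_left, real_inner_smul_right,
    real_inner_self_eq_norm_sq]
  field_simp
  ring

/-- Euler's relation in degree zero: the derivative of a function that is constant along the
open ray through `x` vanishes in the direction `x`. -/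
theorem fderiv_apply_self_eq_zero {E : Type*} [NormedAddCommGroup E] [NormedSpace ℝ E]
    {W : E → ℝ} {x : E} (hW : DifferentiableAt ℝ W x)
    (hhom : ∀ l : ℝ, 0 < l → W (l • x) = W x) : fderiv ℝ W x x = 0 := by
  have hray : HasDerivAt (fun l : ℝ => l • x) x 1 := by
    simpa using (hasDerivAt_id (1 : ℝ)).smul_const x
  have hcomp : HasDerivAt (fun l : ℝ => W (l • x)) (fderiv ℝ W x x) 1 :=
    HasFDerivAt.comp_hasDerivAt (1 : ℝ) (by simpa using hW.hasFDerivAt) hray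
  refine hcomp.unique ((hasDerivAt_const (1 : ℝ) (W x)).congr_of_eventuallyEq ?_)
  filter_upwards [lt_mem_nhds (zero_lt_one' ℝ)] with l hl using hhom l hl

/-- Appendix: if a twice differentiable curve `q` avoiding the origin
satisfies the Euler–Lagrange equation of `S₁` for the potential
`V(q) = f(‖q‖) + W(q)` with `f` differentiable on `(0,∞)` and `W` differentiable and
homogeneous of degree zero, then along the curve (a) `f′(‖q(t)‖) = 0` (the first-order
Lagrangian constraint) and (b) the same equation holds with `V` replaced by `W`. -/
theorem statement14 (D : ℕ) (hD : 1 ≤ D) (m : ℝ) (hm : 0 < m)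
    (f : ℝ → ℝ) (hf : ∀ r : ℝ, 0 < r → DifferentiableAt ℝ f r)
    (W : EuclideanSpace ℝ (Fin D) → ℝ)
    (hW : ∀ x : EuclideanSpace ℝ (Fin D), x ≠ 0 → DifferentiableAt ℝ W x)
    (hhom : ∀ l : ℝ, 0 < l → ∀ x : EuclideanSpace ℝ (Fin D), x ≠ 0 → W (l • x) = W x)
    (I : Set ℝ) (hI : IsOpen I)
    (q : ℝ → EuclideanSpace ℝ (Fin D))
    (hq0 : ∀ t ∈ I, q t ≠ 0)
    (hq1 : ∀ t ∈ I, DifferentiableAt ℝ q t)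
    (hq2 : ∀ t ∈ I, DifferentiableAt ℝ (deriv q) t)
    (hEL : ∀ t ∈ I,
      (0 : EuclideanSpace ℝ (Fin D)) =
        (m / ‖q t‖ ^ 3) • proj (q t) (deriv (deriv q) t)
          - (2 * m / ‖q t‖ ^ 3) • (⟪nhat (q t), deriv q t⟫ • proj (q t) (deriv q t))
          + gradient (fun x => f ‖x‖ + W x) (q t)) :
    ∀ t ∈ I,
      deriv f ‖q t‖ = 0 ∧
      (0 : EuclideanSpace ℝ (Fin D)) =
        (m / ‖q t‖ ^ 3) • proj (q t) (deriv (deriv q) t)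
          - (2 * m / ‖q t‖ ^ 3) • (⟪nhat (q t), deriv q t⟫ • proj (q t) (deriv q t))
          + gradient W (q t) := by
  intro t ht
  have hq := hq0 t ht
  have hr : 0 < ‖q t‖ := norm_pos_iff.mpr hq
  have hnorm : DifferentiableAt ℝ (fun x : EuclideanSpace ℝ (Fin D) => ‖x‖) (q t) :=
    differentiableAt_id.norm ℝ hq
  have hV : HasFDerivAt (fun x => f ‖x‖ + W x)
      (deriv f ‖q t‖ • fderiv ℝ (fun x : EuclideanSpace ℝ (Fin D) => ‖x‖) (q t)
        + fderiv ℝ W (q t)) (q t) :=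
    ((hf _ hr).hasDerivAt.comp_hasFDerivAt (q t) hnorm.hasFDerivAt).add (hW _ hq).hasFDerivAt
  have hradial : ⟪q t, gradient (fun x => f ‖x‖ + W x) (q t)⟫ = deriv f ‖q t‖ * ‖q t‖ := by
    rw [real_inner_comm, ← InnerProductSpace.toDual_apply_apply (𝕜 := ℝ), toDual_gradient,
      hV.fderiv]
    simp [hnorm.fderiv_norm_self,
      fderiv_apply_self_eq_zero (hW _ hq) fun l hl => hhom l hl _ hq]
  have hconstraint : deriv f ‖q t‖ = 0 := by
    have h := congrArg (fun v => ⟪q t, v⟫) (hEL t ht)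
    simp only [inner_add_right, inner_sub_right, real_inner_smul_right, inner_zero_right,
      inner_proj_eq_zero hq, hradial, mul_zero, sub_zero, zero_add] at h
    exact (mul_eq_zero.mp h.symm).resolve_right hr.ne'
  have hgrad : gradient (fun x => f ‖x‖ + W x) (q t) = gradient W (q t) := by
    rw [gradient, gradient, hV.fderiv, hconstraint, zero_smul, zero_add]
  exact ⟨hconstraint, hgrad ▸ hEL t ht⟩
end

section
/- (Velocity Hessian and its kernel for the reparametrization-invariant Lagrangian L₃.) Let m > 0, D ≥ 2, and define L₃(q, v) := (m/‖q‖) ‖Π(q) v‖ for q ≠ 0. Fix q, v ∈ ℝ^D with q ≠ 0 and Π(q)v ≠ 0, and set u := Π(q)v / ‖Π(q)v‖. Then the velocity Hessian of L₃ at (q, v) is M₃(q, v) = ( m / (‖q‖ ‖Π(q)v‖) ) ( Π(q) − u uᵀ ), and its kernel is exactly span{q, v}, which is two-dimensional. -/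
open scoped RealInnerProductSpace

/-- The reparametrization-invariant Lagrangian `L₃(q,v) = (m/‖q‖) ‖Π(q)v‖`. -/
noncomputable def L3 {D : ℕ} (m : ℝ) (q v : EuclideanSpace ℝ (Fin D)) : ℝ :=
  m / ‖q‖ * ‖proj q v‖

section Projection

variable {D : ℕ} {q : EuclideanSpace ℝ (Fin D)}

theorem inner_nhat_self (hq : q ≠ 0) : ⟪nhat q, nhat q⟫ = 1 := by
  have h : ‖q‖ ≠ 0 := norm_ne_zero_iff.mpr hq
  rw [nhat, real_inner_smul_left, real_inner_smul_right, real_inner_self_eq_norm_sq]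
  field_simp

/-- The projection `Π(q)` as a continuous linear map. -/
noncomputable def projCLM (q : EuclideanSpace ℝ (Fin D)) :
    EuclideanSpace ℝ (Fin D) →L[ℝ] EuclideanSpace ℝ (Fin D) :=
  ContinuousLinearMap.id ℝ _ - (innerSL ℝ (nhat q)).smulRight (nhat q)

theorem projCLM_apply (q w : EuclideanSpace ℝ (Fin D)) : projCLM q w = proj q w := by
  simp [projCLM, proj]

theorem inner_proj_proj (hq : q ≠ 0) (w z : EuclideanSpace ℝ (Fin D)) :
    ⟪proj q w, proj q z⟫ = ⟪proj q w, z⟫ := by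
  have h : ⟪proj q w, nhat q⟫ = 0 := by
    rw [proj, inner_sub_left, real_inner_smul_left, inner_nhat_self hq, real_inner_comm]
    ring
  conv_lhs => rw [proj.eq_def q z, inner_sub_right, real_inner_smul_right, h]
  ring

theorem proj_self (hq : q ≠ 0) : proj q q = 0 := by
  have h : ‖q‖ ≠ 0 := norm_ne_zero_iff.mpr hq
  rw [proj, nhat, real_inner_smul_left, real_inner_self_eq_norm_sq, smul_smul, sub_eq_zero]
  rw [show ‖q‖⁻¹ * ‖q‖ ^ 2 * ‖q‖⁻¹ = 1 by field_simp, one_smul]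

theorem proj_smul_add_smul (hq : q ≠ 0) (a b : ℝ) (v : EuclideanSpace ℝ (Fin D)) :
    proj q (a • q + b • v) = b • proj q v := by
  simp only [← projCLM_apply, map_add, map_smul]
  simp [projCLM_apply, proj_self hq]

theorem exists_eq_smul_of_proj_eq_zero {w : EuclideanSpace ℝ (Fin D)} (h : proj q w = 0) :
    ∃ a : ℝ, w = a • q :=
  ⟨⟪nhat q, w⟫ * ‖q‖⁻¹, by rw [mul_smul]; exact sub_eq_zero.mp h⟩

end Projection

section Calculus

variable {E : Type*} [NormedAddCommGroup E] [InnerProductSpace ℝ E]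

theorem hasFDerivAt_norm_of_ne_zero {x : E} (hx : x ≠ 0) :
    HasFDerivAt (fun y : E => ‖y‖) (‖x‖⁻¹ • innerSL ℝ x) x := by
  have h : ‖x‖ ≠ 0 := norm_ne_zero_iff.mpr hx
  have h1 := (hasStrictFDerivAt_norm_sq x).hasFDerivAt.sqrt (pow_ne_zero 2 h)
  simp only [Real.sqrt_sq (norm_nonneg _)] at h1
  convert h1 using 1
  ext y
  simp
  field_simp

theorem hasFDerivAt_inv_norm_smul {x : E} (hx : x ≠ 0) :
    HasFDerivAt (fun y : E => ‖y‖⁻¹ • y)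
      (‖x‖⁻¹ • (ContinuousLinearMap.id ℝ E -
        (innerSL ℝ (‖x‖⁻¹ • x)).smulRight (‖x‖⁻¹ • x))) x := by
  have h : ‖x‖ ≠ 0 := norm_ne_zero_iff.mpr hx
  have h1 := ((hasDerivAt_inv h).comp_hasFDerivAt x
    (hasFDerivAt_norm_of_ne_zero hx)).smul (hasFDerivAt_id x)
  refine h1.congr_fderiv ?_
  ext y
  simp [smul_smul, sub_eq_add_neg, ← neg_smul]
  congr 1
  field_simp

end Calculus

section Lagrangian

variable {D : ℕ} {q v : EuclideanSpace ℝ (Fin D)}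

theorem hasGradientAt_L3 (m : ℝ) (hq : q ≠ 0) (hv : proj q v ≠ 0) :
    HasGradientAt (L3 m q) ((m / ‖q‖) • (‖proj q v‖⁻¹ • proj q v)) v := by
  rw [hasGradientAt_iff_hasFDerivAt]
  rw [← projCLM_apply] at hv
  have h := ((hasFDerivAt_norm_of_ne_zero hv).comp v (projCLM q).hasFDerivAt).const_mul (m / ‖q‖)
  have e : L3 m q = fun w => m / ‖q‖ * ((fun y => ‖y‖) ∘ projCLM q) w := by
    ext w
    simp [L3, projCLM_apply]
  rw [e]
  refine h.congr_fderiv ?_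
  ext y
  simp [projCLM_apply, inner_proj_proj hq]

theorem fderiv_gradient_L3 (m : ℝ) (hq : q ≠ 0) (hv : proj q v ≠ 0)
    (u : EuclideanSpace ℝ (Fin D)) :
    fderiv ℝ (fun w => gradient (L3 m q) w) v u
      = (m / (‖q‖ * ‖proj q v‖)) •
          (proj q u - ⟪‖proj q v‖⁻¹ • proj q v, u⟫ • (‖proj q v‖⁻¹ • proj q v)) := by
  have hv' : projCLM q v ≠ 0 := by rwa [projCLM_apply]
  have hev : (fun w => gradient (L3 m q) w) =ᶠ[nhds v]
      fun w => (m / ‖q‖) • ((fun y => ‖y‖⁻¹ • y) ∘ projCLM q) w := by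
    filter_upwards [(projCLM q).continuous.continuousAt.eventually_ne hv'] with w hw
    rw [projCLM_apply] at hw
    simpa [projCLM_apply] using (hasGradientAt_L3 m hq hw).gradient
  have h := ((hasFDerivAt_inv_norm_smul hv').comp v (projCLM q).hasFDerivAt).const_smul (m / ‖q‖)
  rw [hev.fderiv_eq]
  refine (congrArg (fun f => f u) h.fderiv).trans ?_
  simp [projCLM_apply, real_inner_smul_left, inner_proj_proj hq, smul_smul, div_eq_mul_inv,
    mul_assoc, mul_comm]

theorem fderiv_gradient_L3_eq_zero_iff {m : ℝ} (hm : m ≠ 0) (hq : q ≠ 0) (hv : proj q v ≠ 0)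
    (u : EuclideanSpace ℝ (Fin D)) :
    fderiv ℝ (fun w => gradient (L3 m q) w) v u = 0 ↔ u ∈ Submodule.span ℝ {q, v} := by
  have h1 : ‖q‖ ≠ 0 := norm_ne_zero_iff.mpr hq
  have h2 : ‖proj q v‖ ≠ 0 := norm_ne_zero_iff.mpr hv
  rw [fderiv_gradient_L3 m hq hv, smul_eq_zero_iff_right (div_ne_zero hm (mul_ne_zero h1 h2)),
    Submodule.mem_span_pair]
  constructor
  · intro h
    rw [sub_eq_zero, smul_smul] at h
    set b : ℝ := ⟪‖proj q v‖⁻¹ • proj q v, u⟫ * ‖proj q v‖⁻¹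
    have h3 : proj q (u - b • v) = 0 := by
      rw [← projCLM_apply, map_sub, map_smul, projCLM_apply, projCLM_apply, h, sub_self]
    obtain ⟨a, ha⟩ := exists_eq_smul_of_proj_eq_zero h3
    exact ⟨a, b, by rw [← ha, sub_add_cancel]⟩
  · rintro ⟨a, b, rfl⟩
    rw [real_inner_smul_left, ← inner_proj_proj hq, proj_smul_add_smul hq, real_inner_smul_right,
      real_inner_self_eq_norm_sq, smul_smul, sub_eq_zero]
    congr 1
    field_simp

theorem linearIndependent_pair_of_proj_ne_zero (hq : q ≠ 0) (hv : proj q v ≠ 0) :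
    LinearIndependent ℝ ![q, v] := by
  rw [LinearIndependent.pair_iff]
  intro a b h
  have hb : b = 0 := by
    have h' := proj_smul_add_smul hq a b v
    rw [h, ← projCLM_apply, map_zero] at h'
    exact (smul_eq_zero.mp h'.symm).resolve_right hv
  rw [hb, zero_smul, add_zero] at h
  exact ⟨(smul_eq_zero.mp h).resolve_right hq, hb⟩

end Lagrangian

/-- with `u = Π(q)v/‖Π(q)v‖`, the velocity Hessian of `L₃` at `(q,v)` is
the operator `w ↦ (m/(‖q‖‖Π(q)v‖)) ( Π(q)w − (u·w)u )`, and its kernel is exactly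
`span{q, v}`, which is two-dimensional. -/
theorem statement17 (D : ℕ) (hD : 2 ≤ D) (m : ℝ) (hm : 0 < m)
    (q v : EuclideanSpace ℝ (Fin D)) (hq : q ≠ 0) (hv : proj q v ≠ 0) :
    (∀ u : EuclideanSpace ℝ (Fin D),
      fderiv ℝ (fun w => gradient (L3 m q) w) v u
        = (m / (‖q‖ * ‖proj q v‖)) •
            (proj q u - ⟪‖proj q v‖⁻¹ • proj q v, u⟫ • (‖proj q v‖⁻¹ • proj q v))) ∧
    {u : EuclideanSpace ℝ (Fin D) | fderiv ℝ (fun w => gradient (L3 m q) w) v u = 0}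
      = ↑(Submodule.span ℝ ({q, v} : Set (EuclideanSpace ℝ (Fin D)))) ∧
    Module.finrank ℝ (Submodule.span ℝ ({q, v} : Set (EuclideanSpace ℝ (Fin D)))) = 2 := by
  refine ⟨fderiv_gradient_L3 m hq hv, ?_, ?_⟩
  · ext u
    exact fderiv_gradient_L3_eq_zero_iff hm.ne' hq hv u
  · have h := finrank_span_eq_card (linearIndependent_pair_of_proj_ne_zero hq hv)
    rwa [Matrix.range_cons_cons_empty, Fintype.card_fin] at h
end

section
/- (Vanishing of the matrix F for the reparametrization-invariant Lagrangian L₃.) Let m > 0, D ≥ 2, and define L₃(q, v) := (m/‖q‖) ‖Π(q) v‖ on the open set of (q, v) ∈ ℝ^D × ℝ^D with q ≠ 0 and Π(q)v ≠ 0. Then the mixed second partial derivatives of L₃ are symmetric in the sense that ∂²L₃/∂v^a∂q^b = ∂²L₃/∂v^b∂q^a for all a, b; equivalently, the antisymmetric matrix F₃ with entries F_ab := ∂²L₃/∂v^a∂q^b − ∂²L₃/∂v^b∂q^a vanishes identically, so the two-form Ω_F of the system S₃ is zero. -/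
open scoped RealInnerProductSpace

/-- The mixed second-derivative operator of `L₃`: `A(q,v) : w ↦ D_q( ∇_v L₃ )(q)(w)`,
whose matrix entries are `A_ab = ∂²L₃/∂q^b ∂v^a`. -/
noncomputable def A3op {D : ℕ} (m : ℝ)
    (q v w : EuclideanSpace ℝ (Fin D)) : EuclideanSpace ℝ (Fin D) :=
  fderiv ℝ (fun x => gradient (fun v' => L3 m x v') v) q w

/-- The Gram determinant `‖x‖²‖v‖² − (x·v)²` of two vectors. -/
noncomputable def gramDet {D : ℕ} (x v : EuclideanSpace ℝ (Fin D)) : ℝ :=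
  ⟪x, x⟫ * ⟪v, v⟫ - ⟪x, v⟫ * ⟪x, v⟫

theorem norm_proj_sq {D : ℕ} {x : EuclideanSpace ℝ (Fin D)} (hx : x ≠ 0)
    (v : EuclideanSpace ℝ (Fin D)) : ‖proj x v‖ ^ 2 = gramDet x v / ‖x‖ ^ 2 := by
  have hn : ‖x‖ ≠ 0 := norm_ne_zero_iff.mpr hx
  rw [← real_inner_self_eq_norm_sq]
  simp only [proj, nhat, gramDet, inner_sub_left, inner_sub_right, real_inner_smul_left,
    real_inner_smul_right, real_inner_comm x v]
  simp only [real_inner_self_eq_norm_sq]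
  field_simp
  ring

theorem norm_proj {D : ℕ} {x : EuclideanSpace ℝ (Fin D)} (hx : x ≠ 0)
    (v : EuclideanSpace ℝ (Fin D)) : ‖proj x v‖ = √(gramDet x v) / ‖x‖ := by
  rw [← Real.sqrt_sq (norm_nonneg (proj x v)), norm_proj_sq hx, Real.sqrt_div' _ (sq_nonneg _),
    Real.sqrt_sq (norm_nonneg x)]

theorem gramDet_pos {D : ℕ} {x v : EuclideanSpace ℝ (Fin D)} (hx : x ≠ 0)
    (hv : proj x v ≠ 0) : 0 < gramDet x v := by
  have hn : 0 < ‖x‖ ^ 2 := pow_pos (norm_pos_iff.mpr hx) 2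
  have h : 0 < ‖proj x v‖ ^ 2 := pow_pos (norm_pos_iff.mpr hv) 2
  rw [norm_proj_sq hx] at h
  exact (div_pos_iff_of_pos_right hn).mp h

theorem L3_eq {D : ℕ} (m : ℝ) {x : EuclideanSpace ℝ (Fin D)} (hx : x ≠ 0)
    (v : EuclideanSpace ℝ (Fin D)) : L3 m x v = m / ⟪x, x⟫ * √(gramDet x v) := by
  have hn : ‖x‖ ≠ 0 := norm_ne_zero_iff.mpr hx
  rw [L3, norm_proj hx, real_inner_self_eq_norm_sq]
  field_simp

theorem gradient_L3 {D : ℕ} (m : ℝ) {x v : EuclideanSpace ℝ (Fin D)} (hx : x ≠ 0)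
    (hG : 0 < gramDet x v) :
    gradient (fun v' => L3 m x v') v =
      (m * (⟪x, x⟫ * √(gramDet x v))⁻¹) • (⟪x, x⟫ • v - ⟪x, v⟫ • x) := by
  have hfun : (fun v' => L3 m x v') = fun v' => m / ⟪x, x⟫ * √(gramDet x v') :=
    funext (L3_eq m hx)
  rw [hfun]
  refine HasGradientAt.gradient ?_
  rw [hasGradientAt_iff_hasFDerivAt]
  have hid := hasFDerivAt_id (𝕜 := ℝ) v
  have hxv := (hasFDerivAt_const (𝕜 := ℝ) x v).inner ℝ hid
  have hgram : HasFDerivAt (fun v' => gramDet x v') _ v :=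
    ((hid.inner ℝ hid).const_mul ⟪x, x⟫).sub (hxv.mul hxv)
  refine ((hgram.sqrt hG.ne').const_mul (m / ⟪x, x⟫)).congr_fderiv ?_
  ext w
  have hs : √(gramDet x v) ≠ 0 := (Real.sqrt_pos.mpr hG).ne'
  have hxx : ⟪x, x⟫ ≠ 0 := inner_self_ne_zero.mpr hx
  simp [fderivInnerCLM_apply, real_inner_comm v w]
  field_simp
  ring

/-- the mixed second partial derivatives of `L₃` are symmetric,
`∂²L₃/∂v^a∂q^b = ∂²L₃/∂v^b∂q^a`; equivalently the antisymmetric matrix `F₃` vanishes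
identically, so the two-form `Ω_F` of the system `S₃` is zero. -/
theorem statement18 (D : ℕ) (hD : 2 ≤ D) (m : ℝ) (hm : 0 < m)
    (q v : EuclideanSpace ℝ (Fin D)) (hq : q ≠ 0) (hv : proj q v ≠ 0) :
    ∀ w z : EuclideanSpace ℝ (Fin D),
      ⟪z, A3op m q v w⟫ = ⟪w, A3op m q v z⟫ := by
  intro w z
  have hG := gramDet_pos hq hv
  have hs : √(gramDet q v) ≠ 0 := (Real.sqrt_pos.mpr hG).ne'
  have hqq : ⟪q, q⟫ ≠ 0 := inner_self_ne_zero.mpr hq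
  have hsq : √(gramDet q v) ^ 2 = ‖q‖ ^ 2 * ‖v‖ ^ 2 - ⟪q, v⟫ * ⟪q, v⟫ := by
    rw [Real.sq_sqrt hG.le, gramDet, real_inner_self_eq_norm_sq, real_inner_self_eq_norm_sq]
  have hcont : Continuous fun x => gramDet x v := by unfold gramDet; fun_prop
  have hev : (fun x => gradient (fun v' => L3 m x v') v) =ᶠ[nhds q] fun x =>
      (m * (⟪x, x⟫ * √(gramDet x v))⁻¹) • (⟪x, x⟫ • v - ⟪x, v⟫ • x) := by
    filter_upwards [isOpen_ne.mem_nhds hq, hcont.continuousAt.eventually (lt_mem_nhds hG)]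
      with x hx hxG using gradient_L3 m hx hxG
  have hid := hasFDerivAt_id (𝕜 := ℝ) q
  have hxx := hid.inner ℝ hid
  have hxv := hid.inner ℝ (hasFDerivAt_const (𝕜 := ℝ) v q)
  have hgram : HasFDerivAt (fun x => gramDet x v) _ q := (hxx.mul_const ⟪v, v⟫).sub (hxv.mul hxv)
  have hden := hxx.mul (hgram.sqrt hG.ne')
  have hinv := (hasDerivAt_inv (mul_ne_zero hqq hs)).comp_hasFDerivAt q hden
  have h := (hinv.const_mul m).smul ((hxx.smul_const v).sub (hxv.smul hid))
  have hA := hev.fderiv_eq.trans h.fderiv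
  simp only [A3op, hA]
  simp [inner_sub_right, inner_add_right, real_inner_smul_right, fderivInnerCLM_apply]
  simp only [real_inner_comm q w, real_inner_comm q z, real_inner_comm v w, real_inner_comm v z,
    real_inner_comm w z]
  field_simp
  linear_combination 2 * ‖q‖ ^ 2 * (⟪q, w⟫ * ⟪v, z⟫ - ⟪v, w⟫ * ⟪q, z⟫) * hsq
end
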